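/- Let μ be a Borel measure on ℝ with μ({0}) = 0 and ∫_ℝ min(1,u²) μ(du) < ∞, satisfying μ((0,∞)) > 0 and ∫_{|u|≥1} e^{Cu} μ(du) < ∞ for every C ∈ ℝ. Assume conditions (T1) and (T2), the Kallenberg condition (N1): z² ∫_{(0, 1/|z|)} u² μ(du) / ln|z| → +∞ as |z| → ∞, and Cramer's condition (C): there exists ρ > 0 such that the restriction ϰ of μ to [ρ,∞) satisfies sup_{|z|≥ε} |∫ e^{iyz} ϰ(dy)| < ϰ(ℝ) for every ε > 0. Fix t > 0, let ψ(z) = ∫_ℝ (e^{izu} − 1 − izu) μ(du) for z ∈ ℝ, and for x ≥ 0 let ξ(x) be the unique ξ ≥ 0 with t·M₁(ξ) = x. Then for every k ≥ 0 the function z ↦ z^k e^{−izx + tψ(z)} is absolutely integrable on ℝ, the function p_t(x) := (1/2π) ∫_ℝ e^{−izx + tψ(z)} dz is infinitely differentiable in x with all derivatives bounded, and p_t(x) · √(2π t M₂(ξ(x))) · exp(x·ξ(x) − t·M₀(ξ(x))) → 1 as x → +∞. -/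

import Mathlib

open MeasureTheory Filter Set

/-- The exponential moment functions `M_k` of a Lévy measure `μ`. -/
noncomputable def levyM (μ : Measure ℝ) : ℕ → ℝ → ℝ
  | 0, ξ => ∫ u, (Real.exp (ξ * u) - 1 - ξ * u) ∂μ
  | 1, ξ => ∫ u, u * (Real.exp (ξ * u) - 1) ∂μ
  | (n + 2), ξ => ∫ u, u ^ (n + 2) * Real.exp (ξ * u) ∂μ
/-- The characteristic exponent `ψ(z) = ∫ (e^{izu} − 1 − izu) μ(du)` of a centered Lévy
process with Lévy measure `μ` and no Gaussian part. -/
noncomputable def levyPsi (μ : Measure ℝ) (z : ℝ) : ℂ :=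
  ∫ u, (Complex.exp (Complex.I * z * u) - 1 - Complex.I * z * u) ∂μ

/-- The characteristic exponent of `levyPsi` as a function of the complex Laplace variable. -/
noncomputable def levyPhi (μ : Measure ℝ) (w : ℂ) : ℂ :=
  ∫ u : ℝ, (Complex.exp (w * u) - 1 - w * u) ∂μ

/-- The characteristic exponent of the exponentially tilted, centered process. -/
noncomputable def levyTilt (μ : Measure ℝ) (ξ z : ℝ) : ℂ :=
  ∫ u : ℝ, (Real.exp (ξ * u) : ℂ) * (Complex.exp (Complex.I * z * u) - 1 - Complex.I * z * u) ∂μ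

lemma norm_cexp_sub_one_le (w : ℂ) : ‖Complex.exp w - 1‖ ≤ ‖w‖ * Real.exp ‖w‖ := by
  simpa using Complex.norm_exp_sub_sum_le_norm_mul_exp w 1

lemma norm_cexp_sub_one_sub_le (w : ℂ) :
    ‖Complex.exp w - 1 - w‖ ≤ ‖w‖ ^ 2 * Real.exp ‖w‖ := by
  have := Complex.norm_exp_sub_sum_le_norm_mul_exp w 2
  simpa [Finset.sum_range_succ, sub_sub] using this

lemma norm_cexp_I_mul_sub_le (y : ℝ) :
    ‖Complex.exp (Complex.I * y) - 1 - Complex.I * y + (y : ℂ) ^ 2 / 2‖ ≤ 4 * |y| ^ 3 := by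
  have hn : ‖Complex.I * (y : ℂ)‖ = |y| := by simp
  rcases le_total |y| 1 with h | h
  · have := Complex.exp_bound (x := Complex.I * y) (by rw [hn]; exact h) (n := 3) (by norm_num)
    rw [hn] at this
    have e : Complex.exp (Complex.I * y) - 1 - Complex.I * y + (y : ℂ) ^ 2 / 2
        = Complex.exp (Complex.I * y) - ∑ m ∈ Finset.range 3, (Complex.I * y) ^ m / m.factorial := by
      simp [Finset.sum_range_succ, Nat.factorial, mul_pow]
      ring
    rw [e]
    refine this.trans ?_
    have : 0 ≤ |y| ^ 3 := by positivity
    norm_num [Nat.factorial]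
    linarith
  · have h1 : ‖Complex.exp (Complex.I * y)‖ = 1 := by
      rw [mul_comm]; exact Complex.norm_exp_ofReal_mul_I y
    have h2 : ‖(y : ℂ) ^ 2 / 2‖ = |y| ^ 2 / 2 := by simp
    have h3 := norm_add_le (Complex.exp (Complex.I * y) - 1 - Complex.I * y) ((y : ℂ) ^ 2 / 2)
    have h4 := norm_sub_le (Complex.exp (Complex.I * y) - 1) (Complex.I * y)
    have h5 := norm_sub_le (Complex.exp (Complex.I * y)) 1
    rw [h1, norm_one] at h5
    rw [h2] at h3
    rw [hn] at h4
    nlinarith [mul_nonneg (abs_nonneg y) (sub_nonneg.2 h), pow_pos (lt_of_lt_of_le one_pos h) 2,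
      mul_nonneg (pow_nonneg (abs_nonneg y) 2) (sub_nonneg.2 h)]

lemma cos_le_quartic (y : ℝ) : Real.cos y ≤ 1 - y ^ 2 / 2 + y ^ 4 / 2 := by
  rcases le_total |y| 1 with h | h
  · have := (abs_le.1 (Real.cos_bound h)).2
    rw [Even.pow_abs (by decide)] at this
    have : 0 ≤ y ^ 4 := by positivity
    linarith
  · have h1 : 1 ≤ y ^ 2 := (one_le_sq_iff_one_le_abs y).2 h
    nlinarith [Real.cos_le_one y]

lemma sq_div_four_le_one_sub_cos {y : ℝ} (h : |y| ≤ 1) : y ^ 2 / 4 ≤ 1 - Real.cos y := by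
  have := (abs_le.1 (Real.cos_bound h)).2
  rw [Even.pow_abs (by decide)] at this
  have : y ^ 2 ≤ 1 := (sq_le_one_iff_abs_le_one y).2 h
  nlinarith [sq_nonneg y]

lemma integrable_sq_mul_exp {μ : Measure ℝ} (hμint : Integrable (fun u : ℝ => min 1 (u ^ 2)) μ)
    (hμexp : ∀ C : ℝ, Integrable (fun u : ℝ => Real.exp (C * u)) (μ.restrict {u : ℝ | 1 ≤ |u|}))
    (C : ℝ) : Integrable (fun u : ℝ => u ^ 2 * Real.exp (C * |u|)) μ := by
  have hm : AEStronglyMeasurable (fun u : ℝ => u ^ 2 * Real.exp (C * |u|)) μ :=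
    Continuous.aestronglyMeasurable (by fun_prop)
  have hS : MeasurableSet {u : ℝ | 1 ≤ |u|} := measurableSet_le measurable_const (by fun_prop)
  rw [← integrableOn_univ, ← Set.union_compl_self {u : ℝ | 1 ≤ |u|}]
  refine IntegrableOn.union ?_ ?_
  · refine (((hμexp (C + 1)).add (hμexp (-(C + 1)))).const_mul 2).mono' hm.restrict ?_
    refine Eventually.of_forall fun u => ?_
    rw [Real.norm_of_nonneg (by positivity)]
    have h1 : u ^ 2 ≤ 2 * Real.exp |u| := by
      have := Real.quadratic_le_exp_of_nonneg (abs_nonneg u)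
      rw [sq_abs] at this
      linarith [abs_nonneg u]
    have h2 : Real.exp ((C + 1) * |u|) ≤ Real.exp ((C + 1) * u) + Real.exp (-(C + 1) * u) := by
      rcases abs_cases u with ⟨h, _⟩ | ⟨h, _⟩
      · rw [h]; linarith [Real.exp_pos (-(C + 1) * u)]
      · rw [h, mul_neg, ← neg_mul]; linarith [Real.exp_pos ((C + 1) * u)]
    calc u ^ 2 * Real.exp (C * |u|) ≤ 2 * Real.exp |u| * Real.exp (C * |u|) := by gcongr
      _ = 2 * Real.exp ((C + 1) * |u|) := by rw [mul_assoc, ← Real.exp_add]; ring_nf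
      _ ≤ _ := by simpa using h2
  · refine ((hμint.const_mul (Real.exp |C|)).integrableOn).mono' hm.restrict ?_
    refine (ae_restrict_iff' hS.compl).2 (Eventually.of_forall fun u hu => ?_)
    have hu : |u| < 1 := by simpa using hu
    rw [Real.norm_of_nonneg (by positivity)]
    have h1 : u ^ 2 ≤ 1 := (sq_le_one_iff_abs_le_one u).2 hu.le
    rw [min_eq_right h1, mul_comm]
    gcongr
    calc C * |u| ≤ |C| * |u| := by gcongr; exact le_abs_self C
      _ ≤ |C| * 1 := by gcongr
      _ = |C| := mul_one _

section Tilt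

variable {μ : Measure ℝ}

lemma integrable_of_norm_le_sq_mul_exp {E : Type*} [NormedAddCommGroup E]
    (H : ∀ C : ℝ, Integrable (fun u : ℝ => u ^ 2 * Real.exp (C * |u|)) μ)
    {f : ℝ → E} (hf : AEStronglyMeasurable f μ) (K C : ℝ)
    (h : ∀ u, ‖f u‖ ≤ K * (u ^ 2 * Real.exp (C * |u|))) : Integrable f μ :=
  ((H C).const_mul K).mono' hf (Eventually.of_forall h)

lemma exp_mul_le_exp_abs_mul_abs (ξ u : ℝ) : Real.exp (ξ * u) ≤ Real.exp (|ξ| * |u|) := by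
  rw [← abs_mul]
  exact Real.exp_le_exp.2 (le_abs_self _)

lemma integrable_pow_mul_exp
    (H : ∀ C : ℝ, Integrable (fun u : ℝ => u ^ 2 * Real.exp (C * |u|)) μ) (k : ℕ) (ξ : ℝ) :
    Integrable (fun u : ℝ => u ^ (k + 2) * Real.exp (ξ * u)) μ := by
  refine integrable_of_norm_le_sq_mul_exp H
    (Continuous.aestronglyMeasurable (by fun_prop)) k.factorial (|ξ| + 1) fun u => ?_
  have h1 : |u| ^ k ≤ k.factorial * Real.exp |u| := by
    have := Real.pow_div_factorial_le_exp |u| (abs_nonneg u) k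
    rwa [div_le_iff₀' (by positivity)] at this
  have h2 := exp_mul_le_exp_abs_mul_abs ξ u
  rw [norm_mul, Real.norm_of_nonneg (Real.exp_pos _).le, norm_pow, Real.norm_eq_abs, pow_add,
    sq_abs]
  calc |u| ^ k * u ^ 2 * Real.exp (ξ * u)
      ≤ k.factorial * Real.exp |u| * u ^ 2 * Real.exp (|ξ| * |u|) := by gcongr
    _ = k.factorial * (u ^ 2 * Real.exp ((|ξ| + 1) * |u|)) := by
      rw [add_mul, one_mul, Real.exp_add]; ring

lemma integrable_sq (H : ∀ C : ℝ, Integrable (fun u : ℝ => u ^ 2 * Real.exp (C * |u|)) μ) :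
    Integrable (fun u : ℝ => u ^ 2) μ := by
  simpa using H 0

lemma integrable_cexp_sub
    (H : ∀ C : ℝ, Integrable (fun u : ℝ => u ^ 2 * Real.exp (C * |u|)) μ) (w : ℂ) :
    Integrable (fun u : ℝ => Complex.exp (w * u) - 1 - w * u) μ := by
  refine integrable_of_norm_le_sq_mul_exp H
    (Continuous.aestronglyMeasurable (by fun_prop)) (‖w‖ ^ 2) ‖w‖ fun u => ?_
  refine (norm_cexp_sub_one_sub_le _).trans_eq ?_
  rw [norm_mul, Complex.norm_real, mul_pow, Real.norm_eq_abs, sq_abs, mul_assoc]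

lemma norm_mul_cexp_sub_one_le {w : ℂ} {R : ℝ} (hw : ‖w‖ ≤ R) (u : ℝ) :
    ‖(u : ℂ) * (Complex.exp (w * u) - 1)‖ ≤ R * (u ^ 2 * Real.exp (R * |u|)) := by
  have hR : 0 ≤ R := (norm_nonneg w).trans hw
  rw [norm_mul, Complex.norm_real, Real.norm_eq_abs]
  have h := norm_cexp_sub_one_le (w * u)
  rw [norm_mul, Complex.norm_real, Real.norm_eq_abs] at h
  calc |u| * ‖Complex.exp (w * u) - 1‖ ≤ |u| * (‖w‖ * |u| * Real.exp (‖w‖ * |u|)) := by gcongr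
    _ ≤ |u| * (R * |u| * Real.exp (R * |u|)) := by gcongr
    _ = R * (|u| ^ 2 * Real.exp (R * |u|)) := by ring
    _ = _ := by rw [sq_abs]

lemma integrable_mul_cexp_sub_one
    (H : ∀ C : ℝ, Integrable (fun u : ℝ => u ^ 2 * Real.exp (C * |u|)) μ) (w : ℂ) :
    Integrable (fun u : ℝ => (u : ℂ) * (Complex.exp (w * u) - 1)) μ :=
  integrable_of_norm_le_sq_mul_exp H (Continuous.aestronglyMeasurable (by fun_prop)) ‖w‖ ‖w‖
    fun u => norm_mul_cexp_sub_one_le le_rfl u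

lemma differentiable_levyPhi
    (H : ∀ C : ℝ, Integrable (fun u : ℝ => u ^ 2 * Real.exp (C * |u|)) μ) :
    Differentiable ℂ (levyPhi μ) := fun w => by
  refine (hasDerivAt_integral_of_dominated_loc_of_deriv_le (Metric.ball_mem_nhds w one_pos)
    (F := fun w (u : ℝ) => Complex.exp (w * u) - 1 - w * u)
    (F' := fun w (u : ℝ) => (u : ℂ) * (Complex.exp (w * u) - 1))
    (bound := fun u => (‖w‖ + 1) * (u ^ 2 * Real.exp ((‖w‖ + 1) * |u|)))
    (Eventually.of_forall fun w => Continuous.aestronglyMeasurable (by fun_prop))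
    (integrable_cexp_sub H w) (Continuous.aestronglyMeasurable (by fun_prop))
    (Eventually.of_forall fun u v hv => norm_mul_cexp_sub_one_le ?_ u)
    ((H _).const_mul _) (Eventually.of_forall fun u v _ => ?_)).2.differentiableAt
  · have := norm_sub_norm_le v w
    rw [mem_ball_iff_norm] at hv
    linarith
  · have h1 : HasDerivAt (fun v : ℂ => v * (u : ℂ)) (u : ℂ) v := by
      simpa using (hasDerivAt_id v).mul_const (u : ℂ)
    exact (((h1.cexp).sub_const 1).sub h1).congr_deriv (by ring)

lemma levyPsi_eq_levyPhi (μ : Measure ℝ) (z : ℝ) : levyPsi μ z = levyPhi μ (z * Complex.I) := by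
  simp only [levyPsi, levyPhi, mul_comm Complex.I]

lemma integrable_tilt
    (H : ∀ C : ℝ, Integrable (fun u : ℝ => u ^ 2 * Real.exp (C * |u|)) μ) (ξ z : ℝ) :
    Integrable (fun u : ℝ => (Real.exp (ξ * u) : ℂ) *
      (Complex.exp (Complex.I * z * u) - 1 - Complex.I * z * u)) μ := by
  refine integrable_of_norm_le_sq_mul_exp H
    (Continuous.aestronglyMeasurable (by fun_prop)) (|z| ^ 2) (|z| + |ξ|) fun u => ?_
  have h1 := norm_cexp_sub_one_sub_le (Complex.I * z * u)
  have h2 := exp_mul_le_exp_abs_mul_abs ξ u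
  have h3 : ‖Complex.I * z * u‖ = |z| * |u| := by simp
  rw [h3] at h1
  rw [norm_mul, Complex.norm_real, Real.norm_of_nonneg (Real.exp_pos _).le]
  calc _ ≤ Real.exp (|ξ| * |u|) * ((|z| * |u|) ^ 2 * Real.exp (|z| * |u|)) := by gcongr
    _ = |z| ^ 2 * (|u| ^ 2 * Real.exp ((|z| + |ξ|) * |u|)) := by
      rw [add_mul, Real.exp_add]; ring
    _ = _ := by rw [sq_abs u]

lemma levyPhi_eq_levyTilt
    (H : ∀ C : ℝ, Integrable (fun u : ℝ => u ^ 2 * Real.exp (C * |u|)) μ) (ξ z : ℝ) :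
    levyPhi μ (ξ + z * Complex.I)
      = levyM μ 0 ξ + Complex.I * z * levyM μ 1 ξ + levyTilt μ ξ z := by
  have e0 : (levyM μ 0 ξ : ℂ) = ∫ u : ℝ, (Complex.exp ((ξ : ℂ) * u) - 1 - ξ * u) ∂μ := by
    simp only [levyM]
    rw [← integral_complex_ofReal]
    push_cast
    rfl
  have e1 : (levyM μ 1 ξ : ℂ) = ∫ u : ℝ, (u : ℂ) * (Complex.exp ((ξ : ℂ) * u) - 1) ∂μ := by
    simp only [levyM]
    rw [← integral_complex_ofReal]
    push_cast
    rfl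
  rw [e0, e1, levyTilt, ← integral_const_mul, ← integral_add (integrable_cexp_sub H _)
    ((integrable_mul_cexp_sub_one H _).const_mul _), ← integral_add _ (integrable_tilt H ξ z)]
  · refine integral_congr_ae (Eventually.of_forall fun u => ?_)
    have : Complex.exp ((ξ + z * Complex.I) * u)
        = Complex.exp (ξ * u) * Complex.exp (Complex.I * z * u) := by
      rw [← Complex.exp_add]; ring_nf
    simp only [this, Complex.ofReal_exp, Complex.ofReal_mul]
    ring
  · exact (integrable_cexp_sub H _).add ((integrable_mul_cexp_sub_one H _).const_mul _)

lemma continuous_levyTilt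
    (H : ∀ C : ℝ, Integrable (fun u : ℝ => u ^ 2 * Real.exp (C * |u|)) μ) (ξ : ℝ) :
    Continuous (levyTilt μ ξ) := by
  have h : levyTilt μ ξ = fun z : ℝ => levyPhi μ (ξ + z * Complex.I)
      - (levyM μ 0 ξ + Complex.I * z * levyM μ 1 ξ) := by
    ext z; rw [levyPhi_eq_levyTilt H]; ring
  rw [h]
  have := (differentiable_levyPhi H).continuous
  fun_prop

lemma integrable_exp_mul_one_sub_cos
    (H : ∀ C : ℝ, Integrable (fun u : ℝ => u ^ 2 * Real.exp (C * |u|)) μ) (ξ z : ℝ) :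
    Integrable (fun u : ℝ => Real.exp (ξ * u) * (1 - Real.cos (z * u))) μ := by
  refine ((integrable_pow_mul_exp H 0 ξ).const_mul (z ^ 2 / 2)).mono'
    (Continuous.aestronglyMeasurable (by fun_prop)) (Eventually.of_forall fun u => ?_)
  have h := Real.one_sub_sq_div_two_le_cos (x := z * u)
  have h0 := Real.cos_le_one (z * u)
  rw [Real.norm_of_nonneg (mul_nonneg (Real.exp_pos _).le (by linarith))]
  calc _ ≤ Real.exp (ξ * u) * ((z * u) ^ 2 / 2) := by gcongr; linarith
    _ = _ := by ring

lemma integrable_one_sub_cos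
    (H : ∀ C : ℝ, Integrable (fun u : ℝ => u ^ 2 * Real.exp (C * |u|)) μ) (z : ℝ) :
    Integrable (fun u : ℝ => 1 - Real.cos (z * u)) μ := by
  simpa using integrable_exp_mul_one_sub_cos H 0 z

lemma re_levyTilt
    (H : ∀ C : ℝ, Integrable (fun u : ℝ => u ^ 2 * Real.exp (C * |u|)) μ) (ξ z : ℝ) :
    (levyTilt μ ξ z).re = -∫ u, Real.exp (ξ * u) * (1 - Real.cos (z * u)) ∂μ := by
  have h := integral_re (𝕜 := ℂ) (integrable_tilt H ξ z)
  simp only [RCLike.re_to_complex] at h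
  rw [levyTilt, ← h, ← integral_neg]
  refine integral_congr_ae (Eventually.of_forall fun u => ?_)
  have : Complex.I * z * u = ((z * u : ℝ) : ℂ) * Complex.I := by push_cast; ring
  simp only [this, Complex.re_ofReal_mul, Complex.sub_re, Complex.exp_ofReal_mul_I_re,
    Complex.one_re, Complex.I_re, mul_zero]
  ring

/-- Gaussian domination of the tilted characteristic function near the origin. -/
lemma re_levyTilt_le
    (H : ∀ C : ℝ, Integrable (fun u : ℝ => u ^ 2 * Real.exp (C * |u|)) μ) (ξ z : ℝ) :
    (levyTilt μ ξ z).re ≤ -(z ^ 2 / 2 * levyM μ 2 ξ) + z ^ 4 / 2 * levyM μ 4 ξ := by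
  have i2 := (integrable_pow_mul_exp H 0 ξ).const_mul (-(z ^ 2 / 2))
  have i4 := (integrable_pow_mul_exp H 2 ξ).const_mul (z ^ 4 / 2)
  have e : -(z ^ 2 / 2 * levyM μ 2 ξ) + z ^ 4 / 2 * levyM μ 4 ξ
      = ∫ u : ℝ, (-(z ^ 2 / 2) * (u ^ 2 * Real.exp (ξ * u))
        + z ^ 4 / 2 * (u ^ 4 * Real.exp (ξ * u))) ∂μ := by
    rw [integral_add i2 i4, integral_const_mul, integral_const_mul, neg_mul]
    rfl
  rw [re_levyTilt H, e, ← integral_neg]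
  refine integral_mono (integrable_exp_mul_one_sub_cos H ξ z).neg (i2.add i4) fun u => ?_
  have h := mul_le_mul_of_nonneg_left (cos_le_quartic (z * u)) (Real.exp_pos (ξ * u)).le
  linarith

/-- Quadratic expansion of the tilted exponent; the third absolute moment is split between
the second and the fourth one with weight `r`. -/
lemma norm_levyTilt_add_le
    (H : ∀ C : ℝ, Integrable (fun u : ℝ => u ^ 2 * Real.exp (C * |u|)) μ) (ξ z : ℝ) {r : ℝ}
    (hr : 0 < r) :
    ‖levyTilt μ ξ z + (z ^ 2 / 2 * levyM μ 2 ξ : ℝ)‖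
      ≤ 2 * (r * (z ^ 2 * levyM μ 2 ξ) + z ^ 4 * levyM μ 4 ξ / r) := by
  have e2 : ((z ^ 2 / 2 * levyM μ 2 ξ : ℝ) : ℂ)
      = ∫ u : ℝ, ((z ^ 2 / 2 * (u ^ 2 * Real.exp (ξ * u)) : ℝ) : ℂ) ∂μ := by
    rw [integral_complex_ofReal, integral_const_mul]; rfl
  have e3 : 2 * (r * (z ^ 2 * levyM μ 2 ξ) + z ^ 4 * levyM μ 4 ξ / r)
      = ∫ u : ℝ, (2 * r * z ^ 2 * (u ^ 2 * Real.exp (ξ * u))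
        + 2 * z ^ 4 / r * (u ^ 4 * Real.exp (ξ * u))) ∂μ := by
    rw [integral_add ((integrable_pow_mul_exp H 0 ξ).const_mul _)
      ((integrable_pow_mul_exp H 2 ξ).const_mul _), integral_const_mul, integral_const_mul]
    simp only [levyM]
    ring
  have i2 : Integrable (fun u : ℝ => ((z ^ 2 / 2 * (u ^ 2 * Real.exp (ξ * u)) : ℝ) : ℂ)) μ :=
    ((integrable_pow_mul_exp H 0 ξ).const_mul (z ^ 2 / 2)).ofReal
  rw [e2, e3, levyTilt, ← integral_add (integrable_tilt H ξ z) i2]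
  refine norm_integral_le_of_norm_le (((integrable_pow_mul_exp H 0 ξ).const_mul _).add
      ((integrable_pow_mul_exp H 2 ξ).const_mul _)) (Eventually.of_forall fun u => ?_)
  have e : (Real.exp (ξ * u) : ℂ) * (Complex.exp (Complex.I * z * u) - 1 - Complex.I * z * u)
      + ((z ^ 2 / 2 * (u ^ 2 * Real.exp (ξ * u)) : ℝ) : ℂ)
      = (Real.exp (ξ * u) : ℂ) * (Complex.exp (Complex.I * (z * u : ℝ)) - 1
        - Complex.I * (z * u : ℝ) + ((z * u : ℝ) : ℂ) ^ 2 / 2) := by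
    push_cast
    rw [← mul_assoc Complex.I]
    ring
  rw [e, norm_mul, Complex.norm_real, Real.norm_of_nonneg (Real.exp_pos _).le]
  have h3 : 4 * |z * u| ^ 3 ≤ 2 * (r * (z * u) ^ 2 + (z * u) ^ 4 / r) := by
    have h4 : 0 ≤ (r - |z * u|) ^ 2 * |z * u| ^ 2 / r := by positivity
    have h5 : (r - |z * u|) ^ 2 * |z * u| ^ 2 / r
        = r * |z * u| ^ 2 + |z * u| ^ 4 / r - 2 * |z * u| ^ 3 := by
      field_simp
      ring
    rw [h5, sq_abs, Even.pow_abs (by decide : Even 4)] at h4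
    linarith
  calc _ ≤ Real.exp (ξ * u) * (2 * (r * (z * u) ^ 2 + (z * u) ^ 4 / r)) :=
        mul_le_mul_of_nonneg_left ((norm_cexp_I_mul_sub_le _).trans h3) (Real.exp_pos _).le
    _ = _ := by ring

lemma exp_mul_one_sub_cos_nonneg (ξ z u : ℝ) :
    0 ≤ Real.exp (ξ * u) * (1 - Real.cos (z * u)) :=
  mul_nonneg (Real.exp_pos _).le (by linarith [Real.cos_le_one (z * u)])

lemma setIntegral_one_sub_cos_nonneg (s : Set ℝ) (z : ℝ) :
    0 ≤ ∫ u in s, (1 - Real.cos (z * u)) ∂μ :=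
  integral_nonneg fun u => by simpa using Real.cos_le_one (z * u)

lemma re_levyTilt_le_neg
    (H : ∀ C : ℝ, Integrable (fun u : ℝ => u ^ 2 * Real.exp (C * |u|)) μ) {ξ ρ : ℝ}
    (hξ : 0 ≤ ξ) (hρ : 0 < ρ) (z : ℝ) :
    (levyTilt μ ξ z).re ≤ -((Real.exp (ξ * ρ) - 1) * ∫ u in Ici ρ, (1 - Real.cos (z * u)) ∂μ)
      - ∫ u in Ioi 0, (1 - Real.cos (z * u)) ∂μ := by
  have i := integrable_one_sub_cos H z
  rw [re_levyTilt H, ← integral_indicator measurableSet_Ici, ← integral_indicator measurableSet_Ioi,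
    neg_sub_left, neg_le_neg_iff, ← integral_const_mul, add_comm, ← integral_add
      ((i.indicator measurableSet_Ici).const_mul _) (i.indicator measurableSet_Ioi)]
  refine integral_mono (((i.indicator measurableSet_Ici).const_mul _).add
    (i.indicator measurableSet_Ioi)) (integrable_exp_mul_one_sub_cos H ξ z) fun u => ?_
  have hc : 0 ≤ 1 - Real.cos (z * u) := by linarith [Real.cos_le_one (z * u)]
  by_cases h0 : 0 < u
  · by_cases h1 : ρ ≤ u
    · have : Real.exp (ξ * ρ) ≤ Real.exp (ξ * u) := by gcongr
      simp only [Set.indicator, mem_Ici, h1, if_true, mem_Ioi, h0]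
      nlinarith
    · have : 1 ≤ Real.exp (ξ * u) := Real.one_le_exp (by positivity)
      simp only [Set.indicator, mem_Ici, h1, if_false, if_true, mem_Ioi, h0]
      nlinarith
  · have h1 : ¬ ρ ≤ u := fun h => h0 (hρ.trans_le h)
    simp only [Set.indicator, mem_Ici, h1, if_false, mem_Ioi, h0]
    simpa using exp_mul_one_sub_cos_nonneg ξ z u

lemma re_levyTilt_le_neg_setIntegral
    (H : ∀ C : ℝ, Integrable (fun u : ℝ => u ^ 2 * Real.exp (C * |u|)) μ) {ξ : ℝ}
    (hξ : 0 ≤ ξ) (z : ℝ) :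
    (levyTilt μ ξ z).re ≤ -∫ u in Ioi 0, (1 - Real.cos (z * u)) ∂μ := by
  have h := re_levyTilt_le_neg H hξ one_pos z
  have h1 : 1 ≤ Real.exp (ξ * 1) := Real.one_le_exp (by linarith)
  have := mul_nonneg (sub_nonneg.2 h1) (setIntegral_one_sub_cos_nonneg (μ := μ) (Ici 1) z)
  linarith

/-- The Kallenberg condition makes the characteristic function decay faster than any power. -/
lemma exists_exp_neg_setIntegral_le
    (H : ∀ C : ℝ, Integrable (fun u : ℝ => u ^ 2 * Real.exp (C * |u|)) μ)
    (hN1 : Tendsto (fun z : ℝ => z ^ 2 * (∫ u in Set.Ioo 0 |z|⁻¹, u ^ 2 ∂μ) / Real.log |z|)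
      (comap (fun z : ℝ => |z|) atTop) atTop) {t : ℝ} (ht : 0 < t) (n : ℕ) :
    ∃ C : ℝ, ∀ z : ℝ, Real.exp (-(t * ∫ u in Ioi 0, (1 - Real.cos (z * u)) ∂μ))
      ≤ C * ((1 + z ^ 2) ^ n)⁻¹ := by
  have h := hN1.eventually_ge_atTop (8 * n / t)
  rw [eventually_comap, eventually_atTop] at h
  obtain ⟨Z, hZ⟩ := h
  refine ⟨2 ^ n + (1 + Z ^ 2) ^ n, fun z => ?_⟩
  have hpos : 0 < (1 + z ^ 2) ^ n := by positivity
  rw [← div_eq_mul_inv, le_div_iff₀ hpos]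
  have hP := setIntegral_one_sub_cos_nonneg (μ := μ) (Ioi 0) z
  by_cases hz : Z ≤ |z| ∧ 1 < |z|
  · have hlog : 0 < Real.log |z| := Real.log_pos hz.2
    have hz0 : 0 < |z| := one_pos.trans hz.2
    have h1 := hZ _ hz.1 z rfl
    rw [le_div_iff₀ hlog] at h1
    have h2 : z ^ 2 / 4 * ∫ u in Set.Ioo 0 |z|⁻¹, u ^ 2 ∂μ
        ≤ ∫ u in Ioi 0, (1 - Real.cos (z * u)) ∂μ := by
      have i := integrable_one_sub_cos H z
      calc z ^ 2 / 4 * ∫ u in Set.Ioo 0 |z|⁻¹, u ^ 2 ∂μ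
          = ∫ u in Set.Ioo 0 |z|⁻¹, z ^ 2 / 4 * u ^ 2 ∂μ := (integral_const_mul _ _).symm
        _ ≤ ∫ u in Set.Ioo 0 |z|⁻¹, (1 - Real.cos (z * u)) ∂μ := by
          refine setIntegral_mono_on ((integrable_sq H).const_mul _).integrableOn i.integrableOn
            measurableSet_Ioo fun u hu => ?_
          have : |z * u| ≤ 1 := by
            rw [abs_mul, abs_of_pos hu.1]
            calc |z| * u ≤ |z| * |z|⁻¹ := by gcongr; exact hu.2.le
              _ = 1 := mul_inv_cancel₀ hz0.ne'
          refine le_trans (le_of_eq ?_) (sq_div_four_le_one_sub_cos this)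
          ring
        _ ≤ _ := by
          refine setIntegral_mono_set i.integrableOn
            (Eventually.of_forall fun u => ?_) Ioo_subset_Ioi_self.eventuallyLE
          simpa using Real.cos_le_one (z * u)
    have h3 : 2 * n * Real.log |z| ≤ t * ∫ u in Ioi 0, (1 - Real.cos (z * u)) ∂μ := by
      calc 2 * n * Real.log |z| = t / 4 * (8 * n / t * Real.log |z|) := by field_simp; ring
        _ ≤ t / 4 * (z ^ 2 * ∫ u in Set.Ioo 0 |z|⁻¹, u ^ 2 ∂μ) := by gcongr
        _ = t * (z ^ 2 / 4 * ∫ u in Set.Ioo 0 |z|⁻¹, u ^ 2 ∂μ) := by ring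
        _ ≤ _ := by gcongr
    have h4 : Real.exp (-(t * ∫ u in Ioi 0, (1 - Real.cos (z * u)) ∂μ)) ≤ ((z ^ 2) ^ n)⁻¹ := by
      calc _ ≤ Real.exp (-(2 * n * Real.log |z|)) := by gcongr
        _ = ((z ^ 2) ^ n)⁻¹ := by
          rw [Real.exp_neg, mul_comm, Real.exp_mul, Real.exp_log hz0, ← sq_abs, ← pow_mul,
            ← Real.rpow_natCast]
          push_cast
          rfl
    have h5 : 1 ≤ z ^ 2 := (one_le_sq_iff_one_le_abs z).2 hz.2.le
    calc _ ≤ ((z ^ 2) ^ n)⁻¹ * (2 * z ^ 2) ^ n := by gcongr; linarith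
      _ = 2 ^ n := by rw [mul_pow]; field_simp
      _ ≤ _ := by linarith [pow_nonneg (by positivity : 0 ≤ 1 + Z ^ 2) n]
  · have h1 : Real.exp (-(t * ∫ u in Ioi 0, (1 - Real.cos (z * u)) ∂μ)) ≤ 1 := by
      rw [Real.exp_le_one_iff, neg_nonpos]; positivity
    refine (mul_le_of_le_one_left hpos.le h1).trans ?_
    by_cases h2 : 1 < |z|
    · have h3 : |z| ≤ |Z| := (le_of_not_ge fun h => hz ⟨h, h2⟩).trans (le_abs_self Z)
      have h4 : (1 + z ^ 2) ^ n ≤ (1 + Z ^ 2) ^ n := by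
        gcongr 1
        linarith [sq_le_sq.2 h3]
      linarith [pow_pos (two_pos : (0 : ℝ) < 2) n]
    · have h3 : z ^ 2 ≤ 1 := (sq_le_one_iff_abs_le_one z).2 (not_lt.1 h2)
      have h4 : (1 + z ^ 2) ^ n ≤ 2 ^ n := by
        gcongr
        linarith
      linarith [pow_nonneg (by positivity : 0 ≤ 1 + Z ^ 2) n]

/-- Cramer's condition bounds the characteristic exponent of the large jumps from below. -/
lemma exists_mul_min_le_setIntegral
    (H : ∀ C : ℝ, Integrable (fun u : ℝ => u ^ 2 * Real.exp (C * |u|)) μ) {ρ : ℝ} (hρ : 0 < ρ)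
    (hm : 0 < (μ (Ici ρ)).toReal)
    (hC : ∀ ε > (0 : ℝ), ∃ c : ℝ, c < (μ (Set.Ici ρ)).toReal ∧
      ∀ z : ℝ, ε ≤ |z| →
        ‖(∫ y in Set.Ici ρ, Complex.exp (Complex.I * y * z) ∂μ)‖ ≤ c) :
    ∃ c > 0, ∀ z : ℝ, c * min 1 (z ^ 2) ≤ ∫ u in Ici ρ, (1 - Real.cos (z * u)) ∂μ := by
  obtain ⟨h0, htop⟩ := ENNReal.toReal_pos_iff.1 hm
  have : ∃ n : ℕ, 0 < μ (Icc ρ n) := by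
    by_contra! hn
    refine h0.ne' (measure_mono_null (fun u hu => ?_)
      (measure_iUnion_null fun n : ℕ => le_antisymm (hn n) bot_le))
    obtain ⟨n, hn⟩ := exists_nat_ge u
    exact mem_iUnion.2 ⟨n, hu, hn⟩
  obtain ⟨n, hn⟩ := this
  have hn' : 0 < (μ (Icc ρ n)).toReal :=
    ENNReal.toReal_pos hn.ne' ((measure_mono Icc_subset_Ici_self).trans_lt htop).ne
  have hn0 : (0 : ℝ) < n := by
    obtain ⟨u, hu⟩ := nonempty_of_measure_ne_zero hn.ne'
    exact hρ.trans_le (hu.1.trans hu.2)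
  obtain ⟨c, hc, hcz⟩ := hC (n : ℝ)⁻¹ (by positivity)
  refine ⟨min (ρ ^ 2 / 4 * (μ (Icc ρ n)).toReal) ((μ (Ici ρ)).toReal - c),
    lt_min (by positivity) (sub_pos.2 hc), fun z => ?_⟩
  have i := integrable_one_sub_cos H z
  have hfin : IsFiniteMeasure (μ.restrict (Ici ρ)) := ⟨by simpa using htop⟩
  rcases le_total (n : ℝ)⁻¹ |z| with hz | hz
  · have e : ∫ u in Ici ρ, (1 - Real.cos (z * u)) ∂μ
        = (μ (Ici ρ)).toReal - (∫ y in Set.Ici ρ, Complex.exp (Complex.I * y * z) ∂μ).re := by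
      have i1 : IntegrableOn (fun y : ℝ => Complex.exp (Complex.I * y * z)) (Ici ρ) μ := by
        refine (integrable_const (1 : ℝ)).mono' (Continuous.aestronglyMeasurable (by fun_prop))
          (Eventually.of_forall fun y => ?_)
        rw [show Complex.I * y * z = ((y * z : ℝ) : ℂ) * Complex.I by push_cast; ring,
          Complex.norm_exp_ofReal_mul_I]
      have h := integral_re (𝕜 := ℂ) i1
      simp only [RCLike.re_to_complex] at h
      have i2 : IntegrableOn (fun u : ℝ => Real.cos (z * u)) (Ici ρ) μ := by
        have := (integrable_const (μ := μ.restrict (Ici ρ)) (1 : ℝ)).sub i.integrableOn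
        exact this.congr (Eventually.of_forall fun u => sub_sub_cancel _ _)
      rw [← h, integral_sub (integrable_const _) i2]
      congr 1
      · simp [Measure.real]
      · refine integral_congr_ae (Eventually.of_forall fun y => ?_)
        simp only [show Complex.I * y * z = ((z * y : ℝ) : ℂ) * Complex.I by push_cast; ring]
        exact (Complex.exp_ofReal_mul_I_re _).symm
    rw [e]
    have h1 := (Complex.re_le_norm _).trans (hcz z hz)
    calc _ ≤ ((μ (Ici ρ)).toReal - c) * 1 :=
          mul_le_mul (min_le_right _ _) (min_le_left _ _) (by positivity) (sub_pos.2 hc).le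
      _ ≤ _ := by linarith
  · calc _ ≤ ρ ^ 2 / 4 * (μ (Icc ρ n)).toReal * z ^ 2 :=
          mul_le_mul (min_le_left _ _) (min_le_right _ _) (by positivity) (by positivity)
      _ = ∫ u in Icc ρ n, z ^ 2 * ρ ^ 2 / 4 ∂μ := by
        rw [setIntegral_const, Measure.real, smul_eq_mul]; ring
      _ ≤ ∫ u in Icc ρ n, (1 - Real.cos (z * u)) ∂μ := by
        refine setIntegral_mono_on (integrableOn_const (ne_top_of_lt
          ((measure_mono Icc_subset_Ici_self).trans_lt htop))) i.integrableOn
          measurableSet_Icc fun u hu => ?_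
        have hu0 : 0 < u := hρ.trans_le hu.1
        have : |z * u| ≤ 1 := by
          rw [abs_mul, abs_of_pos hu0]
          calc |z| * u ≤ (n : ℝ)⁻¹ * n := by gcongr; exact hu.2
            _ = 1 := inv_mul_cancel₀ hn0.ne'
        refine le_trans ?_ (sq_div_four_le_one_sub_cos this)
        rw [mul_pow]
        gcongr
        exact hu.1
      _ ≤ _ := by
        refine setIntegral_mono_set i.integrableOn
          (Eventually.of_forall fun u => ?_) Icc_subset_Ici_self.eventuallyLE
        simpa using Real.cos_le_one (z * u)

lemma exp_mul_le_integral_pow_mul_exp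
    (H : ∀ C : ℝ, Integrable (fun u : ℝ => u ^ 2 * Real.exp (C * |u|)) μ) {ρ : ℝ} (hρ : 0 < ρ)
    (hm : 0 < (μ (Ici ρ)).toReal) {k : ℕ} (hk : Even k) {ξ : ℝ} (hξ : 0 ≤ ξ) :
    ρ ^ (k + 2) * (μ (Ici ρ)).toReal * Real.exp (ξ * ρ)
      ≤ levyM μ (k + 2) ξ := by
  have i := integrable_pow_mul_exp H k ξ
  have htop := (ENNReal.toReal_pos_iff.1 hm).2
  have he : Even (k + 2) := hk.add even_two
  calc _ = ∫ u in Ici ρ, ρ ^ (k + 2) * Real.exp (ξ * ρ) ∂μ := by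
        rw [setIntegral_const, Measure.real, smul_eq_mul]; ring
    _ ≤ ∫ u in Ici ρ, u ^ (k + 2) * Real.exp (ξ * u) ∂μ := by
      refine setIntegral_mono_on (integrableOn_const htop.ne) i.integrableOn
          measurableSet_Ici fun u hu => ?_
      exact mul_le_mul (pow_le_pow_left₀ hρ.le hu _)
        (Real.exp_le_exp.2 (mul_le_mul_of_nonneg_left hu hξ)) (Real.exp_pos _).le (he.pow_nonneg u)
    _ ≤ _ := setIntegral_le_integral i
      (Eventually.of_forall fun u => mul_nonneg (he.pow_nonneg u) (Real.exp_pos _).le)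

lemma tendsto_levyM_two_atTop
    (H : ∀ C : ℝ, Integrable (fun u : ℝ => u ^ 2 * Real.exp (C * |u|)) μ) {ρ : ℝ} (hρ : 0 < ρ)
    (hm : 0 < (μ (Ici ρ)).toReal) : Tendsto (levyM μ 2) atTop atTop := by
  have h : Tendsto (fun ξ : ℝ => ρ ^ 2 * (μ (Ici ρ)).toReal * Real.exp (ξ * ρ)) atTop atTop :=
    (Real.tendsto_exp_atTop.comp (tendsto_id.atTop_mul_const hρ)).const_mul_atTop (by positivity)
  refine tendsto_atTop_mono' _ ?_ h
  filter_upwards [eventually_ge_atTop 0] with ξ hξ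
  exact exp_mul_le_integral_pow_mul_exp H hρ hm Even.zero hξ

lemma levyM_four_pos
    (H : ∀ C : ℝ, Integrable (fun u : ℝ => u ^ 2 * Real.exp (C * |u|)) μ) {ρ : ℝ} (hρ : 0 < ρ)
    (hm : 0 < (μ (Ici ρ)).toReal) {ξ : ℝ} (hξ : 0 ≤ ξ) : 0 < levyM μ 4 ξ :=
  lt_of_lt_of_le (by positivity) (exp_mul_le_integral_pow_mul_exp H hρ hm even_two hξ)

lemma tendsto_levyM_four_div
    (H : ∀ C : ℝ, Integrable (fun u : ℝ => u ^ 2 * Real.exp (C * |u|)) μ) {ρ : ℝ} (hρ : 0 < ρ)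
    (hm : 0 < (μ (Ici ρ)).toReal) {γ : ℝ} (hγ : γ ∈ Set.Ioo (0 : ℝ) 1)
    (hT1 : Tendsto (fun ξ => levyM μ 4 ξ / (levyM μ 2 (γ * ξ)) ^ 2) atTop (nhds 0)) :
    Tendsto (fun ξ => levyM μ 4 ξ / (levyM μ 2 ξ) ^ 2) atTop (nhds 0) := by
  have h4 : Tendsto (fun ξ => 4 * (levyM μ 4 ξ / (levyM μ 2 (γ * ξ)) ^ 2)) atTop (nhds 0) := by
    simpa using hT1.const_mul 4
  have hM := tendsto_levyM_two_atTop H hρ hm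
  have hMγ := hM.comp (tendsto_id.const_mul_atTop hγ.1)
  refine tendsto_of_tendsto_of_tendsto_of_le_of_le' tendsto_const_nhds h4 ?_ ?_
  · filter_upwards [eventually_ge_atTop 0] with ξ hξ
    have := levyM_four_pos H hρ hm hξ
    positivity
  · filter_upwards [eventually_ge_atTop 0, hM.eventually_ge_atTop (∫ u, u ^ 2 ∂μ),
      hM.eventually_gt_atTop 0, hMγ.eventually_gt_atTop 0] with ξ hξ h1 h2 h3
    simp only [Function.comp_apply, id_eq] at h3
    have h5 : levyM μ 2 (γ * ξ) ≤ levyM μ 2 ξ + ∫ u, u ^ 2 ∂μ := by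
      simp only [levyM]
      have i := integrable_pow_mul_exp H 0 ξ
      rw [← integral_add i (integrable_sq H)]
      refine integral_mono (integrable_pow_mul_exp H 0 (γ * ξ)) (i.add (integrable_sq H)) fun u => ?_
      have h6 : Real.exp (γ * ξ * u) ≤ Real.exp (ξ * u) + 1 := by
        rcases le_total 0 u with hu | hu
        · have : Real.exp (γ * ξ * u) ≤ Real.exp (ξ * u) := by
            gcongr
            exact mul_le_of_le_one_left hξ hγ.2.le
          linarith
        · have : Real.exp (γ * ξ * u) ≤ 1 := Real.exp_le_one_iff.2
            (mul_nonpos_of_nonneg_of_nonpos (mul_nonneg hγ.1.le hξ) hu)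
          linarith [Real.exp_pos (ξ * u)]
      have := mul_le_mul_of_nonneg_left h6 (sq_nonneg u)
      simpa [mul_add] using this
    have h6 : levyM μ 2 (γ * ξ) ≤ 2 * levyM μ 2 ξ := by linarith
    have := levyM_four_pos H hρ hm hξ
    calc levyM μ 4 ξ / levyM μ 2 ξ ^ 2 = 4 * (levyM μ 4 ξ / (2 * levyM μ 2 ξ) ^ 2) := by
          field_simp; ring
      _ ≤ _ := by gcongr

lemma integrable_const_mul_inv_one_add_sq (C : ℝ) :
    Integrable (fun z : ℝ => C * (1 + z ^ 2)⁻¹) :=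
  integrable_inv_one_add_sq.const_mul C

lemma tendsto_const_mul_inv_one_add_sq (C : ℝ) :
    Tendsto (fun z : ℝ => C * (1 + z ^ 2)⁻¹) atTop (nhds 0) := by
  have h : Tendsto (fun z : ℝ => 1 + z ^ 2) atTop atTop :=
    tendsto_atTop_add_const_left _ _ (tendsto_pow_atTop two_ne_zero)
  simpa using h.inv_tendsto_atTop.const_mul C

/-- Cauchy's theorem in a vertical strip for an entire function with quadratic decay. -/
lemma integral_vertical_line_eq {f : ℂ → ℂ} (hf : Differentiable ℂ f) {ξ C : ℝ} (hξ : 0 ≤ ξ)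
    (hC : ∀ η ∈ Icc 0 ξ, ∀ z : ℝ, ‖f (η + z * Complex.I)‖ ≤ C * (1 + z ^ 2)⁻¹) :
    ∫ z : ℝ, f (ξ + z * Complex.I) = ∫ z : ℝ, f (z * Complex.I) := by
  have hcont := hf.continuous
  have i : ∀ η ∈ Icc 0 ξ, Integrable (fun z : ℝ => f (η + z * Complex.I)) := fun η hη =>
    (integrable_const_mul_inv_one_add_sq C).mono' (Continuous.aestronglyMeasurable (by fun_prop))
      (Eventually.of_forall (hC η hη))
  have lim : ∀ η ∈ Icc 0 ξ, Tendsto (fun T : ℝ => ∫ z in (-T)..T, f (η + z * Complex.I)) atTop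
      (nhds (∫ z : ℝ, f (η + z * Complex.I))) := fun η hη =>
    intervalIntegral_tendsto_integral (i η hη) tendsto_neg_atTop_atBot tendsto_id
  have rect : ∀ T : ℝ, (∫ z in (-T)..T, f (ξ + z * Complex.I))
      - (∫ z in (-T)..T, f ((0 : ℝ) + z * Complex.I))
      = Complex.I * ((∫ η in (0 : ℝ)..ξ, f (η + (-T : ℝ) * Complex.I))
        - ∫ η in (0 : ℝ)..ξ, f (η + T * Complex.I)) := fun T => by
    have h := Complex.integral_boundary_rect_eq_zero_of_differentiableOn f
      (⟨0, -T⟩ : ℂ) (⟨ξ, T⟩ : ℂ) hf.differentiableOn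
    simp only [smul_eq_mul] at h
    linear_combination (-Complex.I) * h
      + ((∫ z in (-T)..T, f (ξ + z * Complex.I)) - ∫ z in (-T)..T, f ((0 : ℝ) + z * Complex.I))
        * Complex.I_sq
  have edge : ∀ s : ℝ → ℝ, (∀ T, s T ^ 2 = T ^ 2) →
      Tendsto (fun T : ℝ => ∫ η in (0 : ℝ)..ξ, f (η + s T * Complex.I)) atTop (nhds 0) := by
    intro s hs
    have h0 : Tendsto (fun T : ℝ => C * (1 + T ^ 2)⁻¹ * |ξ - 0|) atTop (nhds 0) := by
      simpa using (tendsto_const_mul_inv_one_add_sq C).mul_const |ξ - 0|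
    refine squeeze_zero_norm (fun T => ?_) h0
    refine intervalIntegral.norm_integral_le_of_norm_le_const fun η hη => ?_
    rw [uIoc_of_le hξ] at hη
    simpa [hs] using hC η ⟨hη.1.le, hη.2⟩ (s T)
  have h1 := (lim ξ ⟨hξ, le_rfl⟩).sub (lim 0 ⟨le_rfl, hξ⟩)
  have h2 := ((edge (fun T => -T) fun T => neg_sq T).sub (edge id fun T => rfl)).const_mul Complex.I
  simp only [rect] at h1
  have h3 := tendsto_nhds_unique h1 h2
  rw [sub_self, mul_zero, sub_eq_zero] at h3
  simpa using h3

lemma levyTilt_zero (μ : Measure ℝ) (z : ℝ) : levyTilt μ 0 z = levyPsi μ z := by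
  simp [levyTilt, levyPsi]

lemma norm_cexp_mul_levyTilt_le
    (H : ∀ C : ℝ, Integrable (fun u : ℝ => u ^ 2 * Real.exp (C * |u|)) μ) {ξ t : ℝ}
    (hξ : 0 ≤ ξ) (ht : 0 ≤ t) (z : ℝ) :
    ‖Complex.exp (t * levyTilt μ ξ z)‖
      ≤ Real.exp (-(t * ∫ u in Ioi 0, (1 - Real.cos (z * u)) ∂μ)) := by
  rw [Complex.norm_exp, Complex.re_ofReal_mul, ← mul_neg]
  gcongr
  exact re_levyTilt_le_neg_setIntegral H hξ z

lemma levyM_zero_le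
    (H : ∀ C : ℝ, Integrable (fun u : ℝ => u ^ 2 * Real.exp (C * |u|)) μ) {η ξ : ℝ}
    (hη : η ∈ Icc 0 ξ) :
    levyM μ 0 η ≤ ξ ^ 2 * ∫ u, u ^ 2 * Real.exp (ξ * |u|) ∂μ := by
  rw [← integral_const_mul]
  have hb : ∀ u : ℝ, ‖Real.exp (η * u) - 1 - η * u‖ ≤ ξ ^ 2 * (u ^ 2 * Real.exp (ξ * |u|)) := by
    intro u
    have h := norm_cexp_sub_one_sub_le ((η * u : ℝ) : ℂ)
    rw [← Complex.ofReal_exp, ← Complex.ofReal_one, ← Complex.ofReal_sub, ← Complex.ofReal_sub,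
      Complex.norm_real, Complex.norm_real, Real.norm_eq_abs (η * u), abs_mul,
      abs_of_nonneg hη.1, mul_pow, sq_abs, mul_assoc] at h
    have h1 : η ≤ ξ := hη.2
    have h2 : 0 ≤ η := hη.1
    refine h.trans ?_
    gcongr
  exact integral_mono (integrable_of_norm_le_sq_mul_exp H
    (Continuous.aestronglyMeasurable (by fun_prop)) _ _ hb) ((H ξ).const_mul _)
    fun u => (le_abs_self _).trans (hb u)

/-- Moving the line of integration of the Fourier inversion integral to the saddle point. -/
lemma integral_cexp_levyPsi_eq
    (H : ∀ C : ℝ, Integrable (fun u : ℝ => u ^ 2 * Real.exp (C * |u|)) μ) {t : ℝ} (ht : 0 < t)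
    {C : ℝ}
    (hC : ∀ z : ℝ, Real.exp (-(t * ∫ u in Ioi 0, (1 - Real.cos (z * u)) ∂μ)) ≤ C * (1 + z ^ 2)⁻¹)
    {ξ x : ℝ} (hξ : 0 ≤ ξ) (hx : t * levyM μ 1 ξ = x) :
    ∫ z : ℝ, Complex.exp (-(Complex.I * z * x) + t * levyPsi μ z)
      = Real.exp (t * levyM μ 0 ξ - x * ξ) * ∫ z : ℝ, Complex.exp (t * levyTilt μ ξ z) := by
  set f : ℂ → ℂ := fun w => Complex.exp (-(w * x) + t * levyPhi μ w) with hf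
  have hd : Differentiable ℂ f := by
    have := differentiable_levyPhi H
    fun_prop
  have e0 : ∀ η z : ℝ, f (η + z * Complex.I)
      = Complex.exp ((t * levyM μ 0 η - η * x : ℝ) + ((t * levyM μ 1 η - x) * z : ℝ) * Complex.I)
        * Complex.exp (t * levyTilt μ η z) := by
    intro η z
    rw [← Complex.exp_add, hf]
    simp only
    rw [levyPhi_eq_levyTilt H]
    congr 1
    push_cast
    ring
  have hb : ∀ η ∈ Icc 0 ξ, ∀ z : ℝ, ‖f (η + z * Complex.I)‖
      ≤ (Real.exp (t * (ξ ^ 2 * ∫ u, u ^ 2 * Real.exp (ξ * |u|) ∂μ) + ξ * |x|) * C)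
        * (1 + z ^ 2)⁻¹ := by
    intro η hη z
    have h1 := norm_cexp_mul_levyTilt_le H hη.1 ht.le z
    have h2 : -(η * x) ≤ ξ * |x| := by
      calc -(η * x) = η * -x := by ring
        _ ≤ η * |x| := mul_le_mul_of_nonneg_left (neg_le_abs x) hη.1
        _ ≤ ξ * |x| := mul_le_mul_of_nonneg_right hη.2 (abs_nonneg x)
    have h3 := mul_le_mul_of_nonneg_left (levyM_zero_le H hη) ht.le
    rw [e0, norm_mul, Complex.norm_exp, mul_assoc]
    refine mul_le_mul (Real.exp_le_exp.2 ?_) (h1.trans (hC z)) (norm_nonneg _) (Real.exp_pos _).le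
    simp only [Complex.add_re, Complex.ofReal_re, Complex.re_ofReal_mul, Complex.I_re, mul_zero]
    linarith
  have key := integral_vertical_line_eq hd hξ hb
  have e1 : ∀ z : ℝ, Complex.exp (-(Complex.I * z * x) + t * levyPsi μ z)
      = f (z * Complex.I) := fun z => by
    simp only [hf, levyPsi_eq_levyPhi, mul_comm Complex.I]
  simp only [e1]
  rw [← key, ← integral_const_mul]
  refine integral_congr_ae (Eventually.of_forall fun z => ?_)
  simp only [e0, hx, sub_self, zero_mul, Complex.ofReal_zero, add_zero, Complex.ofReal_exp,
    mul_comm ξ]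

/-- The central part of the saddle point integral is asymptotically Gaussian. -/
lemma tendsto_central_integral
    (H : ∀ C : ℝ, Integrable (fun u : ℝ => u ^ 2 * Real.exp (C * |u|)) μ) {t : ℝ} (ht : 0 < t)
    (hM2 : ∀ᶠ ξ in atTop, 0 < levyM μ 2 ξ) (hM4 : ∀ᶠ ξ in atTop, 0 < levyM μ 4 ξ)
    (hM : Tendsto (fun ξ => levyM μ 4 ξ / (levyM μ 2 ξ) ^ 2) atTop (nhds 0)) :
    Tendsto (fun ξ => (Real.sqrt (t * levyM μ 2 ξ) : ℂ)
      * ∫ z in {z : ℝ | z ^ 2 * (2 * levyM μ 4 ξ) ≤ levyM μ 2 ξ},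
        Complex.exp (t * levyTilt μ ξ z)) atTop (nhds (Real.sqrt (2 * Real.pi) : ℂ)) := by
  set F : ℝ → ℝ → ℂ := fun ξ =>
    Set.indicator {z : ℝ | z ^ 2 * (2 * levyM μ 4 ξ) ≤ levyM μ 2 ξ}
      fun z => Complex.exp (t * levyTilt μ ξ z)
  have hS : ∀ ξ, MeasurableSet {z : ℝ | z ^ 2 * (2 * levyM μ 4 ξ) ≤ levyM μ 2 ξ} := fun ξ =>
    measurableSet_le (by fun_prop) measurable_const
  have hFm : ∀ ξ, Measurable (F ξ) := fun ξ => by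
    have := continuous_levyTilt H ξ
    exact (Continuous.measurable (by fun_prop)).indicator (hS ξ)
  have hgauss : ∫ s : ℝ, Complex.exp ((-(s ^ 2 / 2) : ℝ) : ℂ) = (Real.sqrt (2 * Real.pi) : ℂ) := by
    simp only [← Complex.ofReal_exp]
    rw [integral_complex_ofReal]
    have := integral_gaussian (1 / 2)
    rw [show Real.pi / (1 / 2) = 2 * Real.pi by ring] at this
    rw [← this]
    congr 2
    ext s
    ring_nf
  have hsq : ∀ {ξ : ℝ} (s : ℝ), 0 < levyM μ 2 ξ →
      (s / Real.sqrt (t * levyM μ 2 ξ)) ^ 2 * levyM μ 2 ξ = s ^ 2 / t := by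
    intro ξ s h
    rw [div_pow, Real.sq_sqrt (by positivity)]
    field_simp
  have hlim : Tendsto (fun ξ => ∫ s : ℝ, F ξ (s / Real.sqrt (t * levyM μ 2 ξ))) atTop
      (nhds (∫ s : ℝ, Complex.exp ((-(s ^ 2 / 2) : ℝ) : ℂ))) := by
    refine tendsto_integral_filter_of_dominated_convergence (fun s => Real.exp (-(1 / 4) * s ^ 2))
      (Eventually.of_forall fun ξ =>
        ((hFm ξ).comp (measurable_id.div_const _)).aestronglyMeasurable) ?_
      (integrable_exp_neg_mul_sq (by norm_num)) (Eventually.of_forall fun s => ?_)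
    · filter_upwards [hM2] with ξ h2
      refine Eventually.of_forall fun s => ?_
      set z := s / Real.sqrt (t * levyM μ 2 ξ) with hz
      have hz2 := hsq s h2
      rw [← hz] at hz2
      by_cases h : z ^ 2 * (2 * levyM μ 4 ξ) ≤ levyM μ 2 ξ
      · rw [show F ξ z = Complex.exp (t * levyTilt μ ξ z) from
          Set.indicator_of_mem (by rwa [Set.mem_ofPred_eq]) _, Complex.norm_exp, Complex.re_ofReal_mul]
        refine Real.exp_le_exp.2 ?_
        calc t * (levyTilt μ ξ z).re
            ≤ t * (-(z ^ 2 / 2 * levyM μ 2 ξ) + z ^ 4 / 2 * levyM μ 4 ξ) := by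
              gcongr; exact re_levyTilt_le H ξ z
          _ = t * (-(z ^ 2 / 2 * levyM μ 2 ξ) + z ^ 2 / 4 * (z ^ 2 * (2 * levyM μ 4 ξ))) := by ring
          _ ≤ t * (-(z ^ 2 / 2 * levyM μ 2 ξ) + z ^ 2 / 4 * levyM μ 2 ξ) := by gcongr
          _ = -(1 / 4) * (t * (z ^ 2 * levyM μ 2 ξ)) := by ring
          _ = -(1 / 4) * s ^ 2 := by rw [hz2]; field_simp
      · rw [show F ξ z = 0 from
          Set.indicator_of_notMem (by rwa [Set.mem_ofPred_eq]) _, norm_zero]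
        positivity
    · have hev : ∀ᶠ ξ in atTop, F ξ (s / Real.sqrt (t * levyM μ 2 ξ))
          = Complex.exp (t * levyTilt μ ξ (s / Real.sqrt (t * levyM μ 2 ξ))) := by
        have h1 : Tendsto (fun ξ => 2 * s ^ 2 / t * (levyM μ 4 ξ / (levyM μ 2 ξ) ^ 2)) atTop
            (nhds 0) := by simpa using hM.const_mul (2 * s ^ 2 / t)
        filter_upwards [hM2, h1.eventually_le_const one_pos] with ξ h2 h3
        refine Set.indicator_of_mem ?_ _
        have h4 := mul_le_mul_of_nonneg_right h3 h2.le
        have h5 := hsq s h2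
        rw [Set.mem_ofPred_eq]
        calc _ = (s / Real.sqrt (t * levyM μ 2 ξ)) ^ 2 * levyM μ 2 ξ
              * (2 * levyM μ 4 ξ / levyM μ 2 ξ) := by field_simp
          _ = 2 * s ^ 2 / t * (levyM μ 4 ξ / levyM μ 2 ξ ^ 2) * levyM μ 2 ξ := by
            rw [h5]; field_simp
          _ ≤ _ := by simpa using h4
      refine Tendsto.congr' (hev.mono fun ξ h => h.symm) ?_
      refine (Complex.continuous_exp.tendsto _).comp ?_
      have hr : Tendsto (fun ξ => Real.sqrt (levyM μ 4 ξ / (levyM μ 2 ξ) ^ 2)) atTop (nhds 0) := by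
        simpa [Function.comp_def] using (Real.continuous_sqrt.tendsto 0).comp hM
      have hr' : Tendsto (fun ξ => 2 * (s ^ 2 + s ^ 4 / t)
          * Real.sqrt (levyM μ 4 ξ / (levyM μ 2 ξ) ^ 2)) atTop (nhds 0) := by
        simpa using hr.const_mul (2 * (s ^ 2 + s ^ 4 / t))
      refine tendsto_sub_nhds_zero_iff.1 (squeeze_zero_norm' ?_ hr')
      filter_upwards [hM2, hM4] with ξ h2 h4
      set z := s / Real.sqrt (t * levyM μ 2 ξ) with hz
      have hz2 : z ^ 2 * levyM μ 2 ξ = s ^ 2 / t := hsq s h2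
      set r := Real.sqrt (levyM μ 4 ξ / (levyM μ 2 ξ) ^ 2) with hr
      have hr0 : 0 < r := Real.sqrt_pos.2 (by positivity)
      have hr2 : levyM μ 4 ξ = r ^ 2 * levyM μ 2 ξ ^ 2 := by
        rw [hr, Real.sq_sqrt (by positivity)]; field_simp
      have e : (t : ℂ) * levyTilt μ ξ z - ((-(s ^ 2 / 2) : ℝ) : ℂ)
          = t * (levyTilt μ ξ z + (z ^ 2 / 2 * levyM μ 2 ξ : ℝ)) := by
        have : s ^ 2 / 2 = t * (z ^ 2 / 2 * levyM μ 2 ξ) := by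
          rw [div_mul_eq_mul_div, hz2]; field_simp
        rw [this]
        push_cast
        ring
      rw [e, norm_mul, Complex.norm_real, Real.norm_of_nonneg ht.le]
      calc _ ≤ t * (2 * (r * (z ^ 2 * levyM μ 2 ξ) + z ^ 4 * levyM μ 4 ξ / r)) := by
            gcongr; exact norm_levyTilt_add_le H ξ z hr0
        _ = t * (2 * (r * (z ^ 2 * levyM μ 2 ξ) + r * (z ^ 2 * levyM μ 2 ξ) ^ 2)) := by
            rw [hr2]; field_simp
        _ = _ := by rw [hz2]; field_simp
  rw [hgauss] at hlim
  refine hlim.congr' (hM2.mono fun ξ h2 => ?_)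
  rw [MeasureTheory.Measure.integral_comp_div (F ξ), integral_indicator (hS ξ),
    abs_of_nonneg (Real.sqrt_nonneg _), Complex.real_smul]

/-- The tail condition (in the form of eventual inequalities) beats the normalisation. -/
lemma tendsto_sqrt_mul_exp_neg {t c ρ : ℝ} (ht : 0 < t) (hc : 0 < c) (hρ : 0 < ρ) {M L : ℝ → ℝ}
    (hM0 : ∀ᶠ ξ in atTop, 0 < M ξ) (hL : ∀ ξ, 1 ≤ L ξ)
    (hlogL : ∀ᶠ ξ in atTop, Real.log (L ξ) ≤ ρ / 4 * ξ)
    (hlogM : ∀ᶠ ξ in atTop, Real.log (M ξ) ≤ Real.exp (ρ / 4 * ξ)) :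
    Tendsto (fun ξ => Real.sqrt (t * M ξ)
      * Real.exp (-(t * ((Real.exp (ξ * ρ) - 1) * (c * (1 / (2 * L ξ))))))) atTop (nhds 0) := by
  have hy : Tendsto (fun ξ : ℝ => Real.exp (ρ / 4 * ξ)) atTop atTop :=
    Real.tendsto_exp_atTop.comp (tendsto_id.const_mul_atTop (by positivity))
  have hlim : Tendsto (fun ξ : ℝ => Real.sqrt t * Real.exp (-Real.exp (ρ / 4 * ξ))) atTop
      (nhds 0) := by
    simpa using (Real.tendsto_exp_neg_atTop_nhds_zero.comp hy).const_mul (Real.sqrt t)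
  refine squeeze_zero' (Eventually.of_forall fun ξ => by positivity) ?_ hlim
  filter_upwards [hM0, hlogL, hlogM, hy.eventually_ge_atTop 2,
    hy.eventually_ge_atTop (8 / (t * c))] with ξ h0 h1 h2 h3 h4
  set y := Real.exp (ρ / 4 * ξ) with hyd
  have hy0 : 0 < y := Real.exp_pos _
  have e4 : Real.exp (ξ * ρ) = y ^ 4 := by
    rw [hyd, ← Real.exp_nat_mul]; congr 1; push_cast; ring
  have hL0 : 0 < L ξ := one_pos.trans_le (hL ξ)
  have hLy : L ξ ≤ y := (Real.log_le_iff_le_exp hL0).1 h1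
  have hMy : Real.sqrt (M ξ) ≤ Real.exp (y / 2) := by
    rw [Real.sqrt_le_left (Real.exp_pos _).le, ← Real.exp_nat_mul]
    refine ((Real.log_le_iff_le_exp h0).1 h2).trans_eq ?_
    congr 1; push_cast; ring
  have hmain : -(t * ((Real.exp (ξ * ρ) - 1) * (c * (1 / (2 * L ξ))))) ≤ -(2 * y) := by
    rw [neg_le_neg_iff, e4]
    have h5 : y ^ 4 / 2 ≤ y ^ 4 - 1 := by nlinarith [pow_le_pow_left₀ two_pos.le h3 4]
    have h6 : 8 ≤ t * c * y := by
      rw [div_le_iff₀ (by positivity)] at h4; linarith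
    calc 2 * y = 8 * (y / 4) := by ring
      _ ≤ t * c * y * (y / 4) := by gcongr
      _ = t * (c * (y ^ 2 / 4)) := by ring
      _ ≤ t * (c * (y ^ 3 / 4)) := by
        gcongr
        · linarith
        · norm_num
      _ = t * (y ^ 4 / 2 * (c * (1 / (2 * y)))) := by field_simp; ring
      _ ≤ t * ((y ^ 4 - 1) * (c * (1 / (2 * L ξ)))) := by
        have : 0 ≤ y ^ 4 - 1 := le_trans (by positivity) h5
        gcongr
  calc _ ≤ Real.sqrt t * Real.exp (y / 2) * Real.exp (-(2 * y)) := by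
        rw [Real.sqrt_mul ht.le]; gcongr
    _ = Real.sqrt t * Real.exp (y / 2 + -(2 * y)) := by rw [mul_assoc, ← Real.exp_add]
    _ ≤ _ := by gcongr; linarith

/-- Outside the central region the saddle point integral is negligible. -/
lemma tendsto_tail_integral
    (H : ∀ C : ℝ, Integrable (fun u : ℝ => u ^ 2 * Real.exp (C * |u|)) μ) {t C c ρ : ℝ} (ht : 0 < t)
    (hC : ∀ z : ℝ, Real.exp (-(t * ∫ u in Ioi 0, (1 - Real.cos (z * u)) ∂μ)) ≤ C * (1 + z ^ 2)⁻¹)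
    (hc : 0 < c) (hρ : 0 < ρ)
    (hcz : ∀ z : ℝ, c * min 1 (z ^ 2) ≤ ∫ u in Ici ρ, (1 - Real.cos (z * u)) ∂μ)
    (hM2 : ∀ᶠ ξ in atTop, 0 < levyM μ 2 ξ) (hM4 : ∀ᶠ ξ in atTop, 0 < levyM μ 4 ξ)
    (hlogL : ∀ᶠ ξ in atTop, Real.log (max (levyM μ 4 ξ / levyM μ 2 ξ) 1) ≤ ρ / 4 * ξ)
    (hlogM : ∀ᶠ ξ in atTop, Real.log (levyM μ 2 ξ) ≤ Real.exp (ρ / 4 * ξ)) :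
    Tendsto (fun ξ => (Real.sqrt (t * levyM μ 2 ξ) : ℂ)
      * ∫ z in {z : ℝ | z ^ 2 * (2 * levyM μ 4 ξ) ≤ levyM μ 2 ξ}ᶜ,
        Complex.exp (t * levyTilt μ ξ z)) atTop (nhds 0) := by
  have h0 := (tendsto_sqrt_mul_exp_neg ht hc hρ hM2 (fun ξ => le_max_right _ _) hlogL
    hlogM).mul_const (∫ z : ℝ, C * (1 + z ^ 2)⁻¹)
  rw [zero_mul] at h0
  refine squeeze_zero_norm' ?_ h0
  filter_upwards [hM2, hM4, eventually_ge_atTop 0] with ξ h2 h4 hξ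
  set L := max (levyM μ 4 ξ / levyM μ 2 ξ) 1 with hL
  have hL1 : 1 ≤ L := le_max_right _ _
  set S := {z : ℝ | z ^ 2 * (2 * levyM μ 4 ξ) ≤ levyM μ 2 ξ} with hSd
  have hS : MeasurableSet S := measurableSet_le (by fun_prop) measurable_const
  have hexp : 1 ≤ Real.exp (ξ * ρ) := Real.one_le_exp (by positivity)
  rw [norm_mul, Complex.norm_real, Real.norm_of_nonneg (Real.sqrt_nonneg _), mul_assoc]
  refine mul_le_mul_of_nonneg_left ?_ (Real.sqrt_nonneg _)
  rw [← integral_const_mul]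
  have hint := (integrable_const_mul_inv_one_add_sq C).const_mul
    (Real.exp (-(t * ((Real.exp (ξ * ρ) - 1) * (c * (1 / (2 * L)))))))
  have hCpos : ∀ z : ℝ, 0 ≤ C * (1 + z ^ 2)⁻¹ := fun z => (Real.exp_pos _).le.trans (hC z)
  refine (norm_integral_le_of_norm_le hint.integrableOn
    ((ae_restrict_iff' hS.compl).2 (Eventually.of_forall fun z hz => ?_))).trans
    (setIntegral_le_integral hint (Eventually.of_forall fun z =>
      mul_nonneg (Real.exp_pos _).le (hCpos z)))
  have hz : levyM μ 2 ξ < z ^ 2 * (2 * levyM μ 4 ξ) := not_le.1 hz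
  have hmin : 1 / (2 * L) ≤ min 1 (z ^ 2) := by
    refine le_min ?_ ?_
    · rw [div_le_one (by positivity)]; linarith
    · have h5 : levyM μ 4 ξ ≤ L * levyM μ 2 ξ := by
        rw [← div_le_iff₀ h2]; exact le_max_left _ _
      rw [div_le_iff₀ (by positivity)]
      have h6 : levyM μ 2 ξ < z ^ 2 * (2 * (L * levyM μ 2 ξ)) := hz.trans_le (by gcongr)
      have h7 : 1 * levyM μ 2 ξ < z ^ 2 * (2 * L) * levyM μ 2 ξ := by linarith
      exact (lt_of_mul_lt_mul_right h7 h2.le).le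
  calc ‖Complex.exp (t * levyTilt μ ξ z)‖
      ≤ Real.exp (-(t * ((Real.exp (ξ * ρ) - 1) * (c * (1 / (2 * L)))))
          + -(t * ∫ u in Ioi 0, (1 - Real.cos (z * u)) ∂μ)) := by
        rw [Complex.norm_exp, Complex.re_ofReal_mul]
        gcongr
        calc _ ≤ t * (-((Real.exp (ξ * ρ) - 1) * ∫ u in Ici ρ, (1 - Real.cos (z * u)) ∂μ)
              - ∫ u in Ioi 0, (1 - Real.cos (z * u)) ∂μ) := by
              gcongr; exact re_levyTilt_le_neg H hξ hρ z
          _ ≤ t * (-((Real.exp (ξ * ρ) - 1) * (c * (1 / (2 * L))))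
              - ∫ u in Ioi 0, (1 - Real.cos (z * u)) ∂μ) := by
              have : c * (1 / (2 * L)) ≤ ∫ u in Ici ρ, (1 - Real.cos (z * u)) ∂μ :=
                (mul_le_mul_of_nonneg_left hmin hc.le).trans (hcz z)
              have := mul_le_mul_of_nonneg_left this (sub_nonneg.2 hexp)
              gcongr
          _ = _ := by ring
    _ ≤ _ := by rw [Real.exp_add]; gcongr; exact hC z

lemma tendsto_saddle_integral
    (H : ∀ C : ℝ, Integrable (fun u : ℝ => u ^ 2 * Real.exp (C * |u|)) μ) {t C c ρ : ℝ} (ht : 0 < t)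
    (hC : ∀ z : ℝ, Real.exp (-(t * ∫ u in Ioi 0, (1 - Real.cos (z * u)) ∂μ)) ≤ C * (1 + z ^ 2)⁻¹)
    (hc : 0 < c) (hρ : 0 < ρ)
    (hcz : ∀ z : ℝ, c * min 1 (z ^ 2) ≤ ∫ u in Ici ρ, (1 - Real.cos (z * u)) ∂μ)
    (hM2 : Tendsto (levyM μ 2) atTop atTop) (hM4 : ∀ᶠ ξ in atTop, 0 < levyM μ 4 ξ)
    (hM : Tendsto (fun ξ => levyM μ 4 ξ / (levyM μ 2 ξ) ^ 2) atTop (nhds 0))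
    (hT2 : Tendsto
      (fun ξ => (Real.log (max (levyM μ 4 ξ / levyM μ 2 ξ) 1)
        + Real.log (Real.log (levyM μ 2 ξ))) / ξ) atTop (nhds 0)) :
    Tendsto (fun ξ => (Real.sqrt (t * levyM μ 2 ξ) : ℂ)
      * ∫ z : ℝ, Complex.exp (t * levyTilt μ ξ z)) atTop (nhds (Real.sqrt (2 * Real.pi) : ℂ)) := by
  have hM2' := hM2.eventually_gt_atTop 0
  have hlog := Real.tendsto_log_atTop.comp hM2
  have hb : ∀ᶠ ξ in atTop, Real.log (max (levyM μ 4 ξ / levyM μ 2 ξ) 1)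
      + Real.log (Real.log (levyM μ 2 ξ)) ≤ ρ / 4 * ξ := by
    filter_upwards [hT2.eventually_le_const (by positivity : 0 < ρ / 4), eventually_gt_atTop 0]
      with ξ h h0
    rwa [div_le_iff₀ h0] at h
  have hlogL : ∀ᶠ ξ in atTop, Real.log (max (levyM μ 4 ξ / levyM μ 2 ξ) 1) ≤ ρ / 4 * ξ := by
    filter_upwards [hb, hlog.eventually_ge_atTop 1] with ξ h h1
    have := Real.log_nonneg h1
    simp only [Function.comp_apply] at this
    linarith
  have hlogM : ∀ᶠ ξ in atTop, Real.log (levyM μ 2 ξ) ≤ Real.exp (ρ / 4 * ξ) := by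
    filter_upwards [hb, hlog.eventually_gt_atTop 0] with ξ h h1
    have := Real.log_nonneg (le_max_right (levyM μ 4 ξ / levyM μ 2 ξ) 1)
    exact (Real.log_le_iff_le_exp h1).1 (by simp only [Function.comp_apply]; linarith)
  have h := (tendsto_central_integral H ht hM2' hM4 hM).add
    (tendsto_tail_integral H ht hC hc hρ hcz hM2' hM4 hlogL hlogM)
  rw [add_zero] at h
  refine h.congr' ?_
  filter_upwards [eventually_ge_atTop 0] with ξ hξ
  have hcont := continuous_levyTilt H ξ
  have i : Integrable (fun z : ℝ => Complex.exp (t * levyTilt μ ξ z)) :=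
    (integrable_const_mul_inv_one_add_sq C).mono' (Continuous.aestronglyMeasurable (by fun_prop))
      (Eventually.of_forall fun z => (norm_cexp_mul_levyTilt_le H hξ ht.le z).trans (hC z))
  rw [← mul_add, integral_add_compl (measurableSet_le (by fun_prop) measurable_const) i]

end Tilt

section Fourier

variable {g : ℝ → ℂ}

lemma integrable_pow_mul_cexp_mul (hg : Continuous g)
    (hdecay : ∀ n : ℕ, ∃ C : ℝ, ∀ z, ‖g z‖ ≤ C * ((1 + z ^ 2) ^ n)⁻¹) (k : ℕ) (x : ℝ) :
    Integrable (fun z : ℝ => (-(Complex.I * z)) ^ k * (Complex.exp (-(Complex.I * z * x)) * g z)) ∧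
    ∃ C : ℝ, ∀ x z : ℝ,
      ‖(-(Complex.I * z)) ^ k * (Complex.exp (-(Complex.I * z * x)) * g z)‖
        ≤ C * (1 + z ^ 2)⁻¹ := by
  obtain ⟨C, hC⟩ := hdecay (k + 1)
  have hb : ∀ x z : ℝ, ‖(-(Complex.I * z)) ^ k * (Complex.exp (-(Complex.I * z * x)) * g z)‖
      ≤ C * (1 + z ^ 2)⁻¹ := by
    intro x z
    have h1 : ‖Complex.exp (-(Complex.I * z * x))‖ = 1 := by
      rw [show -(Complex.I * z * x) = ((-(z * x) : ℝ) : ℂ) * Complex.I by push_cast; ring,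
        Complex.norm_exp_ofReal_mul_I]
    have h2 : |z| ≤ 1 + z ^ 2 := by nlinarith [sq_abs z, sq_nonneg (|z| - 1), abs_nonneg z]
    rw [norm_mul, norm_mul, h1, one_mul, norm_pow, norm_neg, norm_mul, Complex.norm_I, one_mul,
      Complex.norm_real, Real.norm_eq_abs]
    calc |z| ^ k * ‖g z‖ ≤ (1 + z ^ 2) ^ k * (C * ((1 + z ^ 2) ^ (k + 1))⁻¹) := by
          gcongr; exact hC z
      _ = C * (1 + z ^ 2)⁻¹ := by field_simp; ring
  exact ⟨(integrable_const_mul_inv_one_add_sq C).mono'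
    (Continuous.aestronglyMeasurable (by fun_prop)) (Eventually.of_forall (hb x)), C, hb⟩

/-- The `k`-th derivative of the inverse Fourier integral of `g`. -/
noncomputable def fourierDensity (g : ℝ → ℂ) (k : ℕ) (x : ℝ) : ℝ :=
  (1 / (2 * Real.pi)) *
    (∫ z : ℝ, (-(Complex.I * z)) ^ k * (Complex.exp (-(Complex.I * z * x)) * g z)).re

lemma hasDerivAt_fourierDensity (hg : Continuous g)
    (hdecay : ∀ n : ℕ, ∃ C : ℝ, ∀ z, ‖g z‖ ≤ C * ((1 + z ^ 2) ^ n)⁻¹) (k : ℕ) (x : ℝ) :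
    HasDerivAt (fourierDensity g k) (fourierDensity g (k + 1) x) x := by
  obtain ⟨C, hC⟩ := (integrable_pow_mul_cexp_mul hg hdecay (k + 1) 0).2
  have h := (hasDerivAt_integral_of_dominated_loc_of_deriv_le (μ := volume) (x₀ := x)
    (Filter.univ_mem : (univ : Set ℝ) ∈ nhds x)
    (F := fun (x z : ℝ) => (-(Complex.I * z)) ^ k * (Complex.exp (-(Complex.I * z * x)) * g z))
    (F' := fun (x z : ℝ) =>
      (-(Complex.I * z)) ^ (k + 1) * (Complex.exp (-(Complex.I * z * x)) * g z))
    (Eventually.of_forall fun x => Continuous.aestronglyMeasurable (by fun_prop))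
    (integrable_pow_mul_cexp_mul hg hdecay k x).1
    (Continuous.aestronglyMeasurable (by fun_prop))
    (Eventually.of_forall fun z y _ => hC y z) (integrable_const_mul_inv_one_add_sq C)
    (Eventually.of_forall fun z y _ => ?_)).2
  · exact ((Complex.reCLM.hasFDerivAt.comp_hasDerivAt x h).const_mul (1 / (2 * Real.pi)))
  · have h1 : HasDerivAt (fun y : ℝ => -(Complex.I * z * (y : ℂ))) (-(Complex.I * z)) y := by
      simpa using (Complex.ofRealCLM.hasDerivAt (x := y)).const_mul (-(Complex.I * z))
    exact ((h1.cexp.mul_const (g z)).const_mul _).congr_deriv (by ring)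

lemma iteratedDeriv_fourierDensity (hg : Continuous g)
    (hdecay : ∀ n : ℕ, ∃ C : ℝ, ∀ z, ‖g z‖ ≤ C * ((1 + z ^ 2) ^ n)⁻¹) (n : ℕ) :
    iteratedDeriv n (fourierDensity g 0) = fourierDensity g n := by
  induction n with
  | zero => exact iteratedDeriv_zero
  | succ n ih =>
    rw [iteratedDeriv_succ, ih]
    exact funext fun x => (hasDerivAt_fourierDensity hg hdecay n x).deriv

lemma contDiff_fourierDensity (hg : Continuous g)
    (hdecay : ∀ n : ℕ, ∃ C : ℝ, ∀ z, ‖g z‖ ≤ C * ((1 + z ^ 2) ^ n)⁻¹) :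
    ContDiff ℝ (⊤ : ℕ∞) (fourierDensity g 0) := by
  refine contDiff_of_differentiable_iteratedDeriv fun m _ => ?_
  rw [iteratedDeriv_fourierDensity hg hdecay]
  exact fun x => (hasDerivAt_fourierDensity hg hdecay m x).differentiableAt

lemma exists_abs_fourierDensity_le (hg : Continuous g)
    (hdecay : ∀ n : ℕ, ∃ C : ℝ, ∀ z, ‖g z‖ ≤ C * ((1 + z ^ 2) ^ n)⁻¹) (k : ℕ) :
    ∃ C : ℝ, ∀ x, |fourierDensity g k x| ≤ C := by
  obtain ⟨C, hC⟩ := (integrable_pow_mul_cexp_mul hg hdecay k 0).2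
  refine ⟨1 / (2 * Real.pi) * ∫ z : ℝ, C * (1 + z ^ 2)⁻¹, fun x => ?_⟩
  rw [fourierDensity, abs_mul, abs_of_pos (by positivity)]
  gcongr
  exact (Complex.abs_re_le_norm _).trans
    (norm_integral_le_of_norm_le (integrable_const_mul_inv_one_add_sq C)
      (Eventually.of_forall (hC x)))

end Fourier

lemma tendsto_atTop_of_levyM_one {μ : Measure ℝ}
    (H : ∀ C : ℝ, Integrable (fun u : ℝ => u ^ 2 * Real.exp (C * |u|)) μ) {t : ℝ} (ht : 0 < t)
    {ξ : ℝ → ℝ} (hξ : ∀ x : ℝ, 0 ≤ x → 0 ≤ ξ x ∧ t * levyM μ 1 (ξ x) = x) :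
    Tendsto ξ atTop atTop := by
  refine tendsto_atTop.2 fun A => ?_
  filter_upwards [eventually_ge_atTop 0,
    eventually_gt_atTop (t * ∫ u, A * (u ^ 2 * Real.exp (A * |u|)) ∂μ)] with x hx0 hx
  by_contra! hA
  obtain ⟨h0, h1⟩ := hξ x hx0
  refine hx.not_ge ?_
  rw [← h1]
  gcongr
  rw [levyM]
  refine (Real.le_norm_self _).trans (norm_integral_le_of_norm_le ((H A).const_mul A)
    (Eventually.of_forall fun u => ?_))
  have h := norm_mul_cexp_sub_one_le (w := (ξ x : ℂ)) (R := A)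
    (by rw [Complex.norm_real, Real.norm_of_nonneg h0]; exact hA.le) u
  rwa [← Complex.ofReal_mul, ← Complex.ofReal_exp, ← Complex.ofReal_one, ← Complex.ofReal_sub,
    ← Complex.ofReal_mul, Complex.norm_real] at h

/-- Corollary 3.1, statement (1): under the exponential integrability,
tail conditions (T1), (T2), the Kallenberg condition (N1) and Cramer's condition (C),
for fixed `t > 0` the transition density `p_t(x) = (2π)⁻¹∫ e^{−izx+tψ(z)}dz` of the Lévy
process is well defined, is `C^∞` with bounded derivatives, and
`p_t(x)·√(2πtM₂(ξ(x)))·exp(xξ(x) − tM₀(ξ(x))) → 1` as `x → +∞`. -/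
theorem levy_density_fixed_time
    (μ : Measure ℝ)
    (hμ0 : μ {0} = 0)
    (hμint : Integrable (fun u : ℝ => min 1 (u ^ 2)) μ)
    (hμpos : 0 < μ (Set.Ioi (0 : ℝ)))
    (hμexp : ∀ C : ℝ, Integrable (fun u : ℝ => Real.exp (C * u)) (μ.restrict {u : ℝ | 1 ≤ |u|}))
    (γ : ℝ) (hγ : γ ∈ Set.Ioo (0 : ℝ) 1)
    (hT1 : Tendsto (fun ξ => levyM μ 4 ξ / (levyM μ 2 (γ * ξ)) ^ 2) atTop (nhds 0))
    (hT2 : Tendsto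
      (fun ξ => (Real.log (max (levyM μ 4 ξ / levyM μ 2 ξ) 1)
        + Real.log (Real.log (levyM μ 2 ξ))) / ξ) atTop (nhds 0))
    (hN1 : Tendsto (fun z : ℝ => z ^ 2 * (∫ u in Set.Ioo 0 |z|⁻¹, u ^ 2 ∂μ) / Real.log |z|)
      (comap (fun z : ℝ => |z|) atTop) atTop)
    (hC : ∃ ρ > (0 : ℝ), ∀ ε > (0 : ℝ), ∃ c : ℝ,
      c < (μ (Set.Ici ρ)).toReal ∧
      ∀ z : ℝ, ε ≤ |z| →
        ‖(∫ y in Set.Ici ρ, Complex.exp (Complex.I * y * z) ∂μ)‖ ≤ c)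
    (t : ℝ) (ht : 0 < t)
    (ξ : ℝ → ℝ)
    (hξ : ∀ x : ℝ, 0 ≤ x → 0 ≤ ξ x ∧ t * levyM μ 1 (ξ x) = x)
    (p : ℝ → ℝ)
    (hp : ∀ x : ℝ, p x = (1 / (2 * Real.pi)) *
      (∫ z : ℝ, Complex.exp (-(Complex.I * z * x) + t * levyPsi μ z)).re) :
    (∀ k : ℕ, ∀ x : ℝ,
      Integrable (fun z : ℝ => (z : ℂ) ^ k * Complex.exp (-(Complex.I * z * x) + t * levyPsi μ z)))
    ∧ ContDiff ℝ (⊤ : ℕ∞) p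
    ∧ (∀ n : ℕ, ∃ C : ℝ, ∀ x : ℝ, |iteratedDeriv n p x| ≤ C)
    ∧ Tendsto (fun x => p x * Real.sqrt (2 * Real.pi * t * levyM μ 2 (ξ x))
        * Real.exp (x * ξ x - t * levyM μ 0 (ξ x))) atTop (nhds 1) := by
  have H := integrable_sq_mul_exp hμint hμexp
  have hexp := exists_exp_neg_setIntegral_le H hN1 ht
  obtain ⟨C, hC1⟩ := hexp 1
  simp only [pow_one] at hC1
  obtain ⟨ρ, hρ, hcr⟩ := hC
  have hm : 0 < (μ (Ici ρ)).toReal := by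
    obtain ⟨c, hc, hcz⟩ := hcr 1 one_pos
    exact ((norm_nonneg _).trans (hcz 1 (by simp))).trans_lt hc
  obtain ⟨c, hc, hcz⟩ := exists_mul_min_le_setIntegral H hρ hm hcr
  set g : ℝ → ℂ := fun z => Complex.exp (t * levyPsi μ z) with hgdef
  have hg : Continuous g := by
    have := continuous_levyTilt H 0
    simp only [hgdef, ← levyTilt_zero]
    fun_prop
  have hdecay : ∀ n : ℕ, ∃ C : ℝ, ∀ z, ‖g z‖ ≤ C * ((1 + z ^ 2) ^ n)⁻¹ := fun n => by
    obtain ⟨C, hC⟩ := hexp n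
    refine ⟨C, fun z => ?_⟩
    simp only [hgdef, ← levyTilt_zero]
    exact (norm_cexp_mul_levyTilt_le H le_rfl ht.le z).trans (hC z)
  have hpg : p = fourierDensity g 0 := by
    ext x
    simp only [hp, fourierDensity, hgdef, pow_zero, one_mul, ← Complex.exp_add]
  refine ⟨fun k x => ?_, ?_, fun n => ?_, ?_⟩
  · have h := ((integrable_pow_mul_cexp_mul hg hdecay k x).1).const_mul (Complex.I ^ k)
    refine h.congr (Eventually.of_forall fun z => ?_)
    simp only [hgdef, Complex.exp_add]
    rw [← mul_assoc, ← mul_pow]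
    congr 2
    linear_combination (-(z : ℂ)) * Complex.I_sq
  · rw [hpg]
    exact contDiff_fourierDensity hg hdecay
  · rw [hpg, iteratedDeriv_fourierDensity hg hdecay]
    exact exists_abs_fourierDensity_le hg hdecay n
  · have hM4 : ∀ᶠ η in atTop, 0 < levyM μ 4 η :=
      (eventually_ge_atTop 0).mono fun η hη => levyM_four_pos H hρ hm hη
    have hJ := (tendsto_saddle_integral H ht hC1 hc hρ hcz (tendsto_levyM_two_atTop H hρ hm) hM4
      (tendsto_levyM_four_div H hρ hm hγ hT1) hT2).comp (tendsto_atTop_of_levyM_one H ht hξ)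
    have hre := ((Complex.continuous_re.tendsto _).comp hJ).const_mul
      (Real.sqrt (2 * Real.pi) / (2 * Real.pi))
    rw [Complex.ofReal_re, div_mul_eq_mul_div, Real.mul_self_sqrt (by positivity),
      div_self (by positivity)] at hre
    refine hre.congr' ((eventually_ge_atTop 0).mono fun x hx => ?_)
    obtain ⟨h0, h1⟩ := hξ x hx
    simp only [Function.comp_apply]
    rw [hp, integral_cexp_levyPsi_eq H ht hC1 h0 h1, Complex.re_ofReal_mul, Complex.re_ofReal_mul,
      mul_assoc (2 * Real.pi),
      Real.sqrt_mul (by positivity : 0 ≤ 2 * Real.pi) (t * levyM μ 2 (ξ x))]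
    have he : Real.exp (t * levyM μ 0 (ξ x) - x * ξ x) * Real.exp (x * ξ x - t * levyM μ 0 (ξ x))
        = 1 := by
      rw [← Real.exp_add]; simp
    linear_combination (-(Real.sqrt (2 * Real.pi) / (2 * Real.pi) * (Real.sqrt (t * levyM μ 2 (ξ x))
      * (∫ z : ℝ, Complex.exp (t * levyTilt μ (ξ x) z)).re))) * he
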